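/- Let (hⁱ) be harmonic polynomials converging uniformly on compact sets to a nonconstant harmonic polynomial h, and let B be a closed ball such that Σ_h ∩ int B ≠ ∅ and Σ_h ∩ B equals the closure of Σ_h ∩ int B. Then Σ_{hⁱ} ∩ B → Σ_h ∩ B in the Hausdorff distance. -/

import Mathlib

open MvPolynomial Metric Filter
open scoped ENNReal

/-- Evaluate a multivariate polynomial at a point of Euclidean space. -/
noncomputable def evalPt {n : ℕ} (p : MvPolynomial (Fin n) ℝ)
    (y : EuclideanSpace ℝ (Fin n)) : ℝ :=
  MvPolynomial.eval (fun i => y i) p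

/-- The zero set of a polynomial. -/
def zeroSet {n : ℕ} (p : MvPolynomial (Fin n) ℝ) : Set (EuclideanSpace ℝ (Fin n)) :=
  {y | evalPt p y = 0}

/-- The polynomial y ↦ p(y + x). -/
noncomputable def translatePoly {n : ℕ} (p : MvPolynomial (Fin n) ℝ)
    (x : EuclideanSpace ℝ (Fin n)) : MvPolynomial (Fin n) ℝ :=
  MvPolynomial.bind₁ (fun i => MvPolynomial.X i + MvPolynomial.C (x i)) p

/-- The homogeneous part of degree `k` of `p` centered at `x`. -/
noncomputable def homPart {n : ℕ} (p : MvPolynomial (Fin n) ℝ)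
    (x : EuclideanSpace ℝ (Fin n)) (k : ℕ) : MvPolynomial (Fin n) ℝ :=
  MvPolynomial.homogeneousComponent k (translatePoly p x)

/-- The sup norm of |q| on the closed ball B(0,r), as an extended nonnegative real. -/
noncomputable def supNormBall {n : ℕ} (q : MvPolynomial (Fin n) ℝ) (r : ℝ) : ℝ≥0∞ :=
  ⨆ y ∈ Metric.closedBall (0 : EuclideanSpace ℝ (Fin n)) r, ENNReal.ofReal |evalPt q y|

/-- ζ_k(p,x,r): the relative size of the homogeneous part of degree k of a polynomial of
degree d, centered at x, on the ball of radius r. -/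
noncomputable def zeta {n : ℕ} (d : ℕ) (p : MvPolynomial (Fin n) ℝ)
    (x : EuclideanSpace ℝ (Fin n)) (k : ℕ) (r : ℝ) : ℝ≥0∞ :=
  ⨆ j ∈ (Finset.range (d + 1)).erase k,
    supNormBall (homPart p x j) r / supNormBall (homPart p x k) r

/-- A polynomial is harmonic if its Laplacian vanishes. -/
def IsHarmonic {n : ℕ} (p : MvPolynomial (Fin n) ℝ) : Prop :=
  ∑ i : Fin n, MvPolynomial.pderiv i (MvPolynomial.pderiv i p) = 0

/-- The local flatness θ_Σ(x,r): the normalized minimal Hausdorff distance between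
Σ ∩ B(x,r) and (x + L) ∩ B(x,r) over hyperplanes L through the origin. -/
noncomputable def flatness {n : ℕ} (A : Set (EuclideanSpace ℝ (Fin n)))
    (x : EuclideanSpace ℝ (Fin n)) (r : ℝ) : ℝ :=
  (1 / r) * ⨅ L : {L : Submodule ℝ (EuclideanSpace ℝ (Fin n)) // Module.finrank ℝ L = n - 1},
    Metric.hausdorffDist (A ∩ Metric.closedBall x r)
      (((fun y => x + y) '' (L.1 : Set (EuclideanSpace ℝ (Fin n)))) ∩ Metric.closedBall x r)

/-- Dp(x) ≠ 0 : some partial derivative of p is nonzero at x. -/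
def gradNeZero {n : ℕ} (p : MvPolynomial (Fin n) ℝ) (x : EuclideanSpace ℝ (Fin n)) : Prop :=
  ∃ i : Fin n, MvPolynomial.eval (fun j => x j) (MvPolynomial.pderiv i p) ≠ 0

/-- Sup of |h| on the unit sphere. -/
noncomputable def sphereSup {n : ℕ} (h : MvPolynomial (Fin n) ℝ) : ℝ :=
  sSup ((fun θ => |evalPt h θ|) '' Metric.sphere (0 : EuclideanSpace ℝ (Fin n)) 1)

/-- The polynomial y ↦ p(t·y). -/
noncomputable def dilatePoly {n : ℕ} (p : MvPolynomial (Fin n) ℝ) (t : ℝ) :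
    MvPolynomial (Fin n) ℝ :=
  MvPolynomial.bind₁ (fun i => MvPolynomial.C t * MvPolynomial.X i) p

open MeasureTheory ProbabilityTheory Topology

section GaussianMoments

lemma integrable_pow_gaussianReal (a : ℕ) :
    Integrable (fun x : ℝ => x ^ a) (gaussianReal 0 1) :=
  integrable_pow_of_mem_interior_integrableExpSet (X := fun x : ℝ => x) (by simp) a

lemma integrable_pow_mul_gaussianPDFReal (a : ℕ) :
    Integrable (fun x : ℝ => x ^ a * gaussianPDFReal 0 1 x) := by
  have h := integrable_pow_gaussianReal a
  rw [gaussianReal_of_var_ne_zero _ one_ne_zero,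
    integrable_withDensity_iff_integrable_smul' (measurable_gaussianPDF _ _)
      (ae_of_all _ fun _ => gaussianPDF_lt_top)] at h
  simpa only [toReal_gaussianPDF, smul_eq_mul, mul_comm] using h

lemma hasDerivAt_gaussianPDFReal (x : ℝ) :
    HasDerivAt (gaussianPDFReal 0 1) (-x * gaussianPDFReal 0 1 x) x := by
  have h : HasDerivAt (fun y : ℝ => -(y - 0) ^ 2 / (2 * ((1 : NNReal) : ℝ))) (-x) x := by
    have := (((hasDerivAt_id x).sub_const 0).pow 2).neg.div_const (2 * ((1 : NNReal) : ℝ))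
    refine this.congr_deriv ?_
    simp
    ring
  rw [gaussianPDFReal_def]
  refine (h.exp.const_mul _).congr_deriv ?_
  ring

/-- Integration by parts for the moments of the standard Gaussian. -/
lemma integral_pow_succ_gaussianReal (a : ℕ) :
    ∫ x, x ^ (a + 1) ∂gaussianReal 0 1 = a * ∫ x, x ^ (a - 1) ∂gaussianReal 0 1 := by
  have hint : Integrable (fun x : ℝ => a * (x ^ (a - 1) * gaussianPDFReal 0 1 x)) :=
    (integrable_pow_mul_gaussianPDFReal (a - 1)).const_mul _
  have hint' := integrable_pow_mul_gaussianPDFReal (a + 1)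
  have key := integral_eq_zero_of_hasDerivAt_of_integrable
    (f := fun x : ℝ => x ^ a * gaussianPDFReal 0 1 x)
    (f' := fun x => a * (x ^ (a - 1) * gaussianPDFReal 0 1 x)
      - x ^ (a + 1) * gaussianPDFReal 0 1 x)
    (fun x => ((hasDerivAt_pow a x).mul (hasDerivAt_gaussianPDFReal x)).congr_deriv (by ring))
    (hint.sub hint') (integrable_pow_mul_gaussianPDFReal a)
  rw [integral_sub hint hint', integral_const_mul] at key
  simp only [integral_gaussianReal_eq_integral_smul one_ne_zero, smul_eq_mul]
  simp only [mul_comm (gaussianPDFReal 0 1 _)]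
  linarith

end GaussianMoments

section GaussianExpectation

variable {n : ℕ}

/-- The standard Gaussian measure on `Fin n → ℝ`. -/
noncomputable def stdGaussianPi (n : ℕ) : Measure (Fin n → ℝ) :=
  Measure.pi fun _ => gaussianReal 0 1

instance : (stdGaussianPi n).IsOpenPosMeasure := by
  have : (gaussianReal 0 1).IsOpenPosMeasure :=
    (gaussianReal_absolutelyContinuous' 0 one_ne_zero).isOpenPosMeasure
  unfold stdGaussianPi
  infer_instance

lemma eval_monomial_eq_prod (m : Fin n →₀ ℕ) (a : ℝ) (x : Fin n → ℝ) :
    eval x (monomial m a) = a * ∏ i, x i ^ m i := by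
  rw [eval_monomial, Finsupp.prod_fintype _ _ (fun _ => pow_zero _)]

lemma integrable_eval_stdGaussianPi (p : MvPolynomial (Fin n) ℝ) :
    Integrable (fun x => eval x p) (stdGaussianPi n) := by
  induction p using MvPolynomial.induction_on' with
  | monomial m a =>
    simp only [eval_monomial_eq_prod]
    exact (Integrable.fintype_prod fun i => integrable_pow_gaussianReal (m i)).const_mul a
  | add p q hp hq =>
    simp only [map_add]
    exact hp.add hq

lemma integral_eval_monomial_stdGaussianPi (m : Fin n →₀ ℕ) (a : ℝ) :
    ∫ x, eval x (monomial m a) ∂stdGaussianPi n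
      = a * ∏ i, ∫ x, x ^ m i ∂gaussianReal 0 1 := by
  simp only [eval_monomial_eq_prod, integral_const_mul]
  congr 1
  exact integral_fintype_prod_eq_prod fun i (x : ℝ) => x ^ m i

/-- Gaussian integration by parts for polynomials. -/
lemma integral_eval_X_mul_stdGaussianPi (i : Fin n) (p : MvPolynomial (Fin n) ℝ) :
    ∫ x, eval x (X i * p) ∂stdGaussianPi n = ∫ x, eval x (pderiv i p) ∂stdGaussianPi n := by
  induction p using MvPolynomial.induction_on' with
  | monomial m a =>
    rw [pderiv_monomial, X, monomial_mul, integral_eval_monomial_stdGaussianPi,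
      integral_eval_monomial_stdGaussianPi, ← Finset.mul_prod_erase _ _ (Finset.mem_univ i),
      ← Finset.mul_prod_erase _ _ (Finset.mem_univ i)]
    have hrest : ∀ m' : Fin n →₀ ℕ, (∀ j ≠ i, m' j = m j) →
        ∏ j ∈ Finset.univ.erase i, ∫ x, x ^ m' j ∂gaussianReal 0 1
          = ∏ j ∈ Finset.univ.erase i, ∫ x, x ^ m j ∂gaussianReal 0 1 := fun m' h =>
      Finset.prod_congr rfl fun j hj => by rw [h j (Finset.ne_of_mem_erase hj)]
    rw [hrest (Finsupp.single i 1 + m) fun j hj => by simp [hj.symm],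
      hrest (m - Finsupp.single i 1) fun j hj => by simp [hj.symm]]
    have h1 : (Finsupp.single i 1 + m : Fin n →₀ ℕ) i = m i + 1 := by simp [add_comm]
    have h2 : (m - Finsupp.single i 1 : Fin n →₀ ℕ) i = m i - 1 := by simp
    rw [h1, h2, integral_pow_succ_gaussianReal]
    ring
  | add p q hp hq =>
    simp only [mul_add, map_add]
    rw [integral_add (integrable_eval_stdGaussianPi _) (integrable_eval_stdGaussianPi _),
      integral_add (integrable_eval_stdGaussianPi _) (integrable_eval_stdGaussianPi _), hp, hq]

lemma integral_eval_sum_stdGaussianPi (f : Fin n → MvPolynomial (Fin n) ℝ) :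
    ∫ x, eval x (∑ i, f i) ∂stdGaussianPi n = ∑ i, ∫ x, eval x (f i) ∂stdGaussianPi n := by
  simp only [map_sum]
  exact integral_finsetSum _ fun i _ => integrable_eval_stdGaussianPi (f i)

lemma integral_eval_stdGaussianPi_eq_zero {p : MvPolynomial (Fin n) ℝ} {k : ℕ} (hk : k ≠ 0)
    (hp : p.IsHomogeneous k) (hharm : IsHarmonic p) :
    ∫ x, eval x p ∂stdGaussianPi n = 0 := by
  have h : ∫ x, eval x (k • p) ∂stdGaussianPi n = 0 := by
    rw [← hp.sum_X_mul_pderiv, integral_eval_sum_stdGaussianPi]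
    simp only [integral_eval_X_mul_stdGaussianPi]
    rw [← integral_eval_sum_stdGaussianPi, show _ = _ from hharm]
    simp
  simp only [nsmul_eq_mul, map_mul, map_natCast, integral_const_mul] at h
  exact (mul_eq_zero.mp h).resolve_left (Nat.cast_ne_zero.mpr hk)

lemma MvPolynomial.IsHomogeneous.eq_zero_of_isHarmonic_of_nonneg {p : MvPolynomial (Fin n) ℝ}
    {k : ℕ} (hk : k ≠ 0) (hp : p.IsHomogeneous k) (hharm : IsHarmonic p)
    (hpos : ∀ x, 0 ≤ eval x p) : p = 0 := by
  have h := (integral_eq_zero_iff_of_nonneg hpos (integrable_eval_stdGaussianPi p)).mp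
    (integral_eval_stdGaussianPi_eq_zero hk hp hharm)
  have h' := Measure.eq_of_ae_eq h (MvPolynomial.continuous_eval p) continuous_zero
  exact MvPolynomial.funext fun x => by simpa using congrFun h' x

end GaussianExpectation

section StrongMaximumPrinciple

variable {n : ℕ}

lemma IsHarmonic.homogeneousComponent {p : MvPolynomial (Fin n) ℝ} (hp : IsHarmonic p) (k : ℕ) :
    IsHarmonic (homogeneousComponent k p) := by
  unfold IsHarmonic at hp ⊢
  ext m
  have hm := congrArg (coeff m) hp
  simp only [coeff_sum, coeff_pderiv, coeff_zero, coeff_homogeneousComponent, map_add,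
    Finsupp.degree_single] at hm ⊢
  by_cases h : m.degree + 1 + 1 = k
  · simpa only [h, if_true] using hm
  · simp [h]

lemma IsHarmonic.neg {p : MvPolynomial (Fin n) ℝ} (hp : IsHarmonic p) : IsHarmonic (-p) := by
  unfold IsHarmonic at hp ⊢
  simp [hp]

lemma pderiv_translatePoly (p : MvPolynomial (Fin n) ℝ) (x : EuclideanSpace ℝ (Fin n))
    (i : Fin n) : pderiv i (translatePoly p x) = translatePoly (pderiv i p) x := by
  unfold translatePoly
  induction p using MvPolynomial.induction_on with
  | C a => simp
  | add p q hp hq => simp [hp, hq]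
  | mul_X p j hp =>
    simp only [map_mul, pderiv_mul, hp, map_add, bind₁_X_right, pderiv_X, pderiv_C, add_zero]
    by_cases h : j = i
    · subst h; simp
    · simp [Pi.single_eq_of_ne h]

lemma IsHarmonic.translatePoly {p : MvPolynomial (Fin n) ℝ} (hp : IsHarmonic p)
    (x : EuclideanSpace ℝ (Fin n)) : IsHarmonic (translatePoly p x) := by
  unfold IsHarmonic at hp ⊢
  simp only [pderiv_translatePoly]
  have := congrArg (fun q => _root_.translatePoly q x) hp
  simpa [_root_.translatePoly] using this

lemma eval_translatePoly (p : MvPolynomial (Fin n) ℝ) (x : EuclideanSpace ℝ (Fin n))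
    (y : Fin n → ℝ) : eval y (translatePoly p x) = eval (fun i => y i + x i) p := by
  unfold translatePoly
  induction p using MvPolynomial.induction_on with
  | C a => simp
  | add p q hp hq => simp [hp, hq]
  | mul_X p j hp => simp [hp]

lemma eval_smul_of_isHomogeneous {p : MvPolynomial (Fin n) ℝ} {k : ℕ} (hp : p.IsHomogeneous k)
    (t : ℝ) (x : Fin n → ℝ) : eval (t • x) p = t ^ k * eval x p := by
  simp only [eval_eq, Finset.mul_sum]
  refine Finset.sum_congr rfl fun m hm => ?_
  have hdeg : ∑ i ∈ m.support, m i = k := by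
    rw [← Finsupp.degree_apply, Finsupp.degree_eq_weight_one]
    exact hp (mem_support_iff.mp hm)
  simp only [Pi.smul_apply, smul_eq_mul, mul_pow, Finset.prod_mul_distrib,
    Finset.prod_pow_eq_pow_sum]
  rw [hdeg, mul_left_comm]

lemma Polynomial.coeff_nonneg_of_eventually_eval_nonneg {P : Polynomial ℝ} {k : ℕ}
    (hlow : ∀ j < k, P.coeff j = 0) (hP : ∀ᶠ t in 𝓝[>] (0 : ℝ), 0 ≤ P.eval t) :
    0 ≤ P.coeff k := by
  obtain ⟨Q, rfl⟩ := Polynomial.X_pow_dvd_iff.mpr hlow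
  rw [Polynomial.coeff_X_pow_mul', if_pos le_rfl, Nat.sub_self,
    Polynomial.coeff_zero_eq_eval_zero]
  refine ge_of_tendsto
    ((Q.continuous.tendsto 0).mono_left (nhdsWithin_le_nhds (s := Set.Ioi 0))) ?_
  filter_upwards [hP, self_mem_nhdsWithin] with t ht ht0
  rw [Polynomial.eval_mul, Polynomial.eval_pow, Polynomial.eval_X] at ht
  exact nonneg_of_mul_nonneg_right ht (pow_pos ht0 k)

lemma IsHarmonic.eq_zero_of_eventually_nonneg_zero {p : MvPolynomial (Fin n) ℝ}
    (hp : IsHarmonic p) (h0 : eval 0 p = 0) (hpos : ∀ᶠ x in 𝓝 (0 : Fin n → ℝ), 0 ≤ eval x p) :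
    p = 0 := by
  suffices hcomp : ∀ k, MvPolynomial.homogeneousComponent k p = 0 by
    rw [← sum_homogeneousComponent p]
    exact Finset.sum_eq_zero fun k _ => hcomp k
  intro k
  induction k using Nat.strong_induction_on with
  | _ k ih =>
  rcases eq_or_ne k 0 with rfl | hk
  · rw [homogeneousComponent_zero, ← constantCoeff_eq, ← MvPolynomial.eval_zero, h0, C_0]
  refine (homogeneousComponent_isHomogeneous k p).eq_zero_of_isHarmonic_of_nonneg hk
    (hp.homogeneousComponent k) fun x => ?_
  let P : Polynomial ℝ := ∑ j ∈ Finset.range (p.totalDegree + 1),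
    Polynomial.monomial j (eval x (MvPolynomial.homogeneousComponent j p))
  have hcoeff : ∀ j, P.coeff j = eval x (MvPolynomial.homogeneousComponent j p) := by
    intro j
    simp only [P, Polynomial.finsetSum_coeff, Polynomial.coeff_monomial, Finset.sum_ite_eq',
      Finset.mem_range]
    split_ifs with hj
    · rfl
    · rw [homogeneousComponent_eq_zero _ _ (by omega), map_zero]
  have heval : ∀ t, P.eval t = eval (t • x) p := by
    intro t
    conv_rhs => rw [← sum_homogeneousComponent p]
    simp only [P, Polynomial.eval_finsetSum, Polynomial.eval_monomial, map_sum]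
    refine Finset.sum_congr rfl fun j _ => ?_
    rw [eval_smul_of_isHomogeneous (homogeneousComponent_isHomogeneous j p), mul_comm]
  rw [← hcoeff]
  refine Polynomial.coeff_nonneg_of_eventually_eval_nonneg
    (fun j hj => by rw [hcoeff, ih j hj, map_zero]) ?_
  simp only [heval]
  have hlim : Tendsto (fun t : ℝ => t • x) (𝓝[>] 0) (𝓝 0) := by
    have : Continuous fun t : ℝ => t • x := by fun_prop
    simpa using (this.tendsto 0).mono_left nhdsWithin_le_nhds
  exact hlim.eventually hpos

/-- Strong maximum principle: a harmonic polynomial with a local minimum value `0` is zero. -/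
lemma IsHarmonic.eq_zero_of_eventually_nonneg {p : MvPolynomial (Fin n) ℝ}
    (hp : IsHarmonic p) {x : EuclideanSpace ℝ (Fin n)} (h0 : evalPt p x = 0)
    (hpos : ∀ᶠ y in 𝓝 x, 0 ≤ evalPt p y) : p = 0 := by
  have hq : _root_.translatePoly p x = 0 := by
    refine (hp.translatePoly x).eq_zero_of_eventually_nonneg_zero ?_ ?_
    · rw [eval_translatePoly]
      simpa [evalPt] using h0
    · have hlim : Tendsto (fun y : Fin n → ℝ => WithLp.toLp 2 y + x) (𝓝 0) (𝓝 x) := by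
        have : Continuous fun y : Fin n → ℝ => WithLp.toLp 2 y + x := by fun_prop
        simpa using this.tendsto 0
      filter_upwards [hlim.eventually hpos] with y hy
      simpa [eval_translatePoly, evalPt] using hy
  refine MvPolynomial.funext fun y => ?_
  have := eval_translatePoly p x (fun i => y i - x i)
  simpa [hq] using this.symm

lemma IsHarmonic.exists_evalPt_neg {p : MvPolynomial (Fin n) ℝ} (hp : IsHarmonic p)
    (hne : p ≠ 0) {x : EuclideanSpace ℝ (Fin n)} (hx : x ∈ zeroSet p)
    {U : Set (EuclideanSpace ℝ (Fin n))} (hU : U ∈ 𝓝 x) : ∃ y ∈ U, evalPt p y < 0 := by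
  by_contra! H
  exact hne (hp.eq_zero_of_eventually_nonneg hx (mem_of_superset hU H))

lemma evalPt_neg (p : MvPolynomial (Fin n) ℝ) (x : EuclideanSpace ℝ (Fin n)) :
    evalPt (-p) x = -evalPt p x := by
  simp [evalPt]

lemma IsHarmonic.exists_evalPt_pos {p : MvPolynomial (Fin n) ℝ} (hp : IsHarmonic p)
    (hne : p ≠ 0) {x : EuclideanSpace ℝ (Fin n)} (hx : x ∈ zeroSet p)
    {U : Set (EuclideanSpace ℝ (Fin n))} (hU : U ∈ 𝓝 x) : ∃ y ∈ U, 0 < evalPt p y := by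
  have hx' : x ∈ zeroSet (-p) := by
    rw [zeroSet, Set.mem_ofPred_eq, evalPt_neg, show evalPt p x = 0 from hx, neg_zero]
  obtain ⟨y, hyU, hy⟩ := hp.neg.exists_evalPt_neg (neg_ne_zero.mpr hne) hx' hU
  exact ⟨y, hyU, by simpa [evalPt_neg] using hy⟩

end StrongMaximumPrinciple

section Convergence

variable {n : ℕ}

@[fun_prop]
lemma continuous_evalPt (p : MvPolynomial (Fin n) ℝ) : Continuous (evalPt p) :=
  (MvPolynomial.continuous_eval p).comp (by fun_prop)

lemma isClosed_zeroSet (p : MvPolynomial (Fin n) ℝ) : IsClosed (zeroSet p) :=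
  isClosed_singleton.preimage (continuous_evalPt p)

/-- Near a zero of a nonzero harmonic polynomial there are zeros of nearby polynomials. -/
lemma IsHarmonic.eventually_exists_mem_zeroSet {p : MvPolynomial (Fin n) ℝ} (hp : IsHarmonic p)
    (hne : p ≠ 0) {ps : ℕ → MvPolynomial (Fin n) ℝ}
    (hconv : ∀ y, Tendsto (fun i => evalPt (ps i) y) atTop (𝓝 (evalPt p y)))
    {x : EuclideanSpace ℝ (Fin n)} (hx : x ∈ zeroSet p) {r : ℝ} (hr : 0 < r) :
    ∀ᶠ i in atTop, ∃ y ∈ ball x r, y ∈ zeroSet (ps i) := by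
  obtain ⟨a, ha, hapos⟩ := hp.exists_evalPt_pos hne hx (ball_mem_nhds x hr)
  obtain ⟨b, hb, hbneg⟩ := hp.exists_evalPt_neg hne hx (ball_mem_nhds x hr)
  filter_upwards [(hconv a).eventually (lt_mem_nhds hapos),
    (hconv b).eventually (gt_mem_nhds hbneg)] with i hia hib
  exact (convex_ball x r).isPreconnected.intermediate_value hb ha
    (continuous_evalPt (ps i)).continuousOn ⟨hib.le, hia.le⟩

/-- Zeros in a compact set `K` of polynomials converging uniformly on `K` accumulate only at zeros
of the limit. -/
lemma eventually_zeroSet_inter_subset {p : MvPolynomial (Fin n) ℝ}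
    {ps : ℕ → MvPolynomial (Fin n) ℝ} {K : Set (EuclideanSpace ℝ (Fin n))} (hK : IsCompact K)
    (hconv : TendstoUniformlyOn (fun i y => evalPt (ps i) y) (fun y => evalPt p y) atTop K)
    {U : Set (EuclideanSpace ℝ (Fin n))} (hU : IsOpen U) (hpU : zeroSet p ∩ K ⊆ U) :
    ∀ᶠ i in atTop, zeroSet (ps i) ∩ K ⊆ U := by
  have hcont : ContinuousOn (fun y => |evalPt p y|) (K \ U) := by fun_prop
  obtain ⟨δ, hδ, hle⟩ := (hK.diff hU).exists_forall_le' (a := 0) hcont fun y hy =>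
    abs_pos.mpr fun h0 => hy.2 (hpU ⟨h0, hy.1⟩)
  filter_upwards [Metric.tendstoUniformlyOn_iff.mp hconv δ hδ] with i hi y hy
  by_contra hyU
  have h1 := hi y hy.2
  rw [show evalPt (ps i) y = 0 from hy.1, Real.dist_eq, sub_zero] at h1
  exact absurd (hle y ⟨hy.2, hyU⟩) (not_le.mpr h1)

end Convergence

/-- If moreover Σ_h ∩ B is the closure of Σ_h ∩ int B, then Σ_{hⁱ} ∩ B → Σ_h ∩ B in the
Hausdorff distance. -/
theorem zeroSet_hausdorff_convergence {n : ℕ} (hs : ℕ → MvPolynomial (Fin n) ℝ)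
    (h : MvPolynomial (Fin n) ℝ) (hharm : ∀ i, IsHarmonic (hs i)) (hh : IsHarmonic h)
    (hnc : h.totalDegree ≠ 0)
    (hconv : ∀ K : Set (EuclideanSpace ℝ (Fin n)), IsCompact K →
      TendstoUniformlyOn (fun i y => evalPt (hs i) y) (fun y => evalPt h y)
        Filter.atTop K)
    (c : EuclideanSpace ℝ (Fin n)) (R : ℝ)
    (hB : (zeroSet h ∩ interior (Metric.closedBall c R)).Nonempty)
    (hcl : zeroSet h ∩ Metric.closedBall c R
      = closure (zeroSet h ∩ interior (Metric.closedBall c R))) :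
    Filter.Tendsto
      (fun i => EMetric.hausdorffEdist (zeroSet (hs i) ∩ Metric.closedBall c R)
        (zeroSet h ∩ Metric.closedBall c R))
      Filter.atTop (nhds 0) := by
  have hne : h ≠ 0 := by
    rintro rfl
    exact hnc totalDegree_zero
  have hBc : IsCompact (closedBall c R) := isCompact_closedBall c R
  have hpt : ∀ y, Tendsto (fun i => evalPt (hs i) y) atTop (𝓝 (evalPt h y)) := fun y =>
    (hconv {y} isCompact_singleton).tendsto_at rfl
  rw [ENNReal.tendsto_nhds_zero]
  intro ε' hε'
  obtain ⟨ε, hε, hεε'⟩ := ENNReal.exists_nnreal_pos_mul_lt (ENNReal.one_ne_top) hε'.ne'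
  have hε0 : (0 : ℝ) < ε := hε
  rw [mul_one] at hεε'
  set A := zeroSet h ∩ closedBall c R with hA
  have hAc : IsCompact A := hBc.inter_left (isClosed_zeroSet h)
  have hcover : A ⊆ ⋃ y ∈ zeroSet h ∩ interior (closedBall c R), ball y (ε / 2) := by
    intro x hx
    rw [hcl, Metric.mem_closure_iff] at hx
    obtain ⟨y, hy, hxy⟩ := hx (ε / 2) (half_pos hε0)
    exact Set.mem_biUnion hy hxy
  obtain ⟨T, hTsub, hTfin, hTcover⟩ :=
    hAc.elim_finite_subcover_image (fun _ _ => isOpen_ball) hcover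
  have hlower : ∀ᶠ i in atTop, ∀ y ∈ T,
      ∃ z ∈ ball y (ε / 2), z ∈ zeroSet (hs i) ∩ closedBall c R := by
    rw [hTfin.eventually_all]
    intro y hy
    obtain ⟨r, hr, hrsub⟩ := Metric.isOpen_iff.mp isOpen_interior y (hTsub hy).2
    filter_upwards [hh.eventually_exists_mem_zeroSet hne hpt (hTsub hy).1
      (lt_min hr (half_pos hε0))] with i hi
    obtain ⟨z, hz, hz0⟩ := hi
    exact ⟨z, ball_subset_ball (min_le_right _ _) hz, hz0,
      interior_subset (hrsub (ball_subset_ball (min_le_left _ _) hz))⟩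
  filter_upwards [hlower, eventually_zeroSet_inter_subset hBc (hconv _ hBc)
    (isOpen_thickening (δ := ε) (E := A)) (self_subset_thickening hε0 A)] with i hlow hup
  refine (hausdorffEDist_le_of_mem_edist (r := ε) (fun x hx => ?_) fun x hx => ?_).trans hεε'.le
  · obtain ⟨y, hy, hxy⟩ := mem_thickening_iff.mp (hup hx)
    refine ⟨y, hy, ?_⟩
    rw [edist_nndist, ENNReal.coe_le_coe, ← NNReal.coe_le_coe, coe_nndist]
    exact hxy.le
  · obtain ⟨y, hy, hxy⟩ := Set.mem_iUnion₂.mp (hTcover hx)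
    obtain ⟨z, hz, hzmem⟩ := hlow y hy
    refine ⟨z, hzmem, ?_⟩
    rw [edist_nndist, ENNReal.coe_le_coe, ← NNReal.coe_le_coe, coe_nndist]
    have h1 := dist_triangle_right x z y
    rw [mem_ball] at hxy hz
    linarith
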